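/- arXiv:1305.2473 — 11 statements merged into one kernel-verified Lean document; each statement's English description precedes it below -/
import Mathlib

section
/- Let γ > 0 and let φ : [0,∞) → ℝ satisfy φ(1) = -1 and φ(z) ≥ -z^{1+γ} for all z ≥ 0. Then for all nonnegative measurable functions f, g on a σ-finite measure space with ⟨f^{1+γ}⟩ < ∞ and 0 < ⟨g^{1+γ}⟩ < ∞, the Hölder score satisfies S(f,g) ≥ S(f,f), i.e. φ(⟨f g^γ⟩/⟨g^{1+γ}⟩)·⟨g^{1+γ}⟩ + ⟨f^{1+γ}⟩ ≥ 0. -/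
open MeasureTheory

/-- Young's inequality for the exponents `1 + γ` and `(1 + γ) / γ`. -/
lemma mul_rpow_le_add_rpow_one_add {γ a b : ℝ} (hγ : 0 < γ) (ha : 0 ≤ a) (hb : 0 ≤ b) :
    a * b ^ γ ≤ a ^ (1 + γ) / (1 + γ) + γ / (1 + γ) * b ^ (1 + γ) := by
  have hpq : (1 + γ).HolderConjugate ((1 + γ) / γ) := by
    rw [Real.holderConjugate_iff]
    exact ⟨by linarith, by field_simp⟩
  have h := Real.young_inequality_of_nonneg ha (Real.rpow_nonneg hb γ) hpq
  rw [← Real.rpow_mul hb, mul_div_cancel₀ _ hγ.ne'] at h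
  exact h.trans_eq (by field_simp)

/-- A form of Hölder's inequality for the pairing `⟨f g^γ⟩`. -/
lemma rpow_integral_div_mul_le {Ω : Type*} [MeasurableSpace Ω] {m : Measure Ω} {γ : ℝ}
    (hγ : 0 < γ) {f g : Ω → ℝ} (hf0 : ∀ ω, 0 ≤ f ω) (hg0 : ∀ ω, 0 ≤ g ω)
    (hfi : Integrable (fun ω => f ω ^ (1 + γ)) m)
    (hgi : Integrable (fun ω => g ω ^ (1 + γ)) m)
    (hgpos : 0 < ∫ ω, g ω ^ (1 + γ) ∂m) :
    ((∫ ω, f ω * g ω ^ γ ∂m) / ∫ ω, g ω ^ (1 + γ) ∂m) ^ (1 + γ) * (∫ ω, g ω ^ (1 + γ) ∂m)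
      ≤ ∫ ω, f ω ^ (1 + γ) ∂m := by
  set G := ∫ ω, g ω ^ (1 + γ) ∂m
  set z := (∫ ω, f ω * g ω ^ γ ∂m) / G with hz
  have hz0 : 0 ≤ z := div_nonneg
    (integral_nonneg fun ω => mul_nonneg (hf0 ω) (Real.rpow_nonneg (hg0 ω) γ)) hgpos.le
  have hA : ∫ ω, f ω * g ω ^ γ ∂m = z * G := by rw [hz, div_mul_cancel₀ _ hgpos.ne']
  have hmono : ∫ ω, z ^ γ * (f ω * g ω ^ γ) ∂m ≤
      ∫ ω, (f ω ^ (1 + γ) / (1 + γ) + γ / (1 + γ) * z ^ (1 + γ) * g ω ^ (1 + γ)) ∂m := by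
    refine integral_mono_of_nonneg (.of_forall fun ω => ?_)
      ((hfi.div_const _).add (hgi.const_mul _)) (.of_forall fun ω => ?_)
    · exact mul_nonneg (Real.rpow_nonneg hz0 γ)
        (mul_nonneg (hf0 ω) (Real.rpow_nonneg (hg0 ω) γ))
    · have h := mul_rpow_le_add_rpow_one_add hγ (hf0 ω) (mul_nonneg hz0 (hg0 ω))
      rw [Real.mul_rpow hz0 (hg0 ω), Real.mul_rpow hz0 (hg0 ω)] at h
      dsimp only
      linarith
  rw [integral_const_mul, integral_add (hfi.div_const _) (hgi.const_mul _), integral_div,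
    integral_const_mul, hA] at hmono
  have hpow : z ^ (1 + γ) = z * z ^ γ := by
    rw [Real.rpow_add_of_nonneg hz0 zero_le_one hγ.le, Real.rpow_one]
  have hle : z ^ (1 + γ) * G ≤
      (∫ ω, f ω ^ (1 + γ) ∂m) / (1 + γ) + γ / (1 + γ) * z ^ (1 + γ) * G :=
    le_trans (by rw [hpow]; linarith) hmono
  have h1 : 0 < 1 + γ := by linarith
  field_simp at hle
  linarith

/-- The Hölder score with parameter `γ > 0` and function `φ` (satisfying `φ 1 = -1` and
`φ z ≥ -z^(1+γ)` for `z ≥ 0`) satisfies `S(f,g) ≥ S(f,f)`, i.e.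
`φ(⟨f g^γ⟩/⟨g^(1+γ)⟩)·⟨g^(1+γ)⟩ + ⟨f^(1+γ)⟩ ≥ 0`. -/
theorem holder_score_ge_entropy {Ω : Type*} [MeasurableSpace Ω] (m : Measure Ω)
    [SigmaFinite m] (γ : ℝ) (hγ : 0 < γ) (φ : ℝ → ℝ) (hφ1 : φ 1 = -1)
    (hφ : ∀ z : ℝ, 0 ≤ z → -z ^ (1 + γ) ≤ φ z)
    (f g : Ω → ℝ) (hfm : Measurable f) (hgm : Measurable g)
    (hf0 : ∀ ω, 0 ≤ f ω) (hg0 : ∀ ω, 0 ≤ g ω)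
    (hfi : Integrable (fun ω => f ω ^ (1 + γ)) m)
    (hgi : Integrable (fun ω => g ω ^ (1 + γ)) m)
    (hgpos : 0 < ∫ ω, g ω ^ (1 + γ) ∂m) :
    0 ≤ φ ((∫ ω, f ω * g ω ^ γ ∂m) / ∫ ω, g ω ^ (1 + γ) ∂m) * (∫ ω, g ω ^ (1 + γ) ∂m)
      + ∫ ω, f ω ^ (1 + γ) ∂m := by
  have hz0 : 0 ≤ (∫ ω, f ω * g ω ^ γ ∂m) / ∫ ω, g ω ^ (1 + γ) ∂m := div_nonneg
    (integral_nonneg fun ω => mul_nonneg (hf0 ω) (Real.rpow_nonneg (hg0 ω) γ)) hgpos.le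
  have hφz := mul_le_mul_of_nonneg_right (hφ _ hz0) hgpos.le
  have hle := rpow_integral_div_mul_le hγ hf0 hg0 hfi hgi hgpos
  linarith
end

section
/- Let γ > 0 and let φ : [0,∞) → ℝ satisfy φ(1) = -1 and φ(z) ≥ -z^{1+γ} for all z ≥ 0. If p and q are probability densities (nonnegative measurable functions with ⟨p⟩ = ⟨q⟩ = 1 and ⟨p^{1+γ}⟩, ⟨q^{1+γ}⟩ ∈ (0,∞)) and the Hölder score satisfies S(p,q) = S(p,p), i.e. φ(⟨p q^γ⟩/⟨q^{1+γ}⟩)·⟨q^{1+γ}⟩ = -⟨p^{1+γ}⟩, then p = q almost everywhere. -/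
open MeasureTheory

/-- Strict Young inequality with conjugate exponents `1 + γ` and `(1 + γ) / γ`. -/
theorem young_rpow_lt_of_ne {γ x y : ℝ} (hγ : 0 < γ) (hx : 0 ≤ x) (hy : 0 ≤ y) (hxy : x ≠ y) :
    (1 + γ) * (x * y ^ γ) < x ^ (1 + γ) + γ * y ^ (1 + γ) := by
  have hs : 1 + γ ≠ 0 := by positivity
  rcases hy.eq_or_lt with rfl | hy
  · have : 0 < x ^ (1 + γ) := Real.rpow_pos_of_pos (lt_of_le_of_ne hx hxy.symm) _
    simpa [Real.zero_rpow hs, Real.zero_rpow hγ.ne'] using this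
  · have h := one_add_mul_self_lt_rpow_one_add (s := x / y - 1) (p := 1 + γ)
      (by linarith [div_nonneg hx hy.le])
      (by rw [sub_ne_zero, Ne, div_eq_one_iff_eq hy.ne']; exact hxy) (by linarith)
    rw [add_sub_cancel, Real.div_rpow hx hy.le,
      lt_div_iff₀ (Real.rpow_pos_of_pos hy _)] at h
    have hys : y ^ (1 + γ) = y * y ^ γ := by rw [Real.rpow_add hy, Real.rpow_one]
    have e : (1 + (1 + γ) * (x / y - 1)) * y ^ (1 + γ)
        = (1 + γ) * (x * y ^ γ) - γ * y ^ (1 + γ) := by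
      rw [hys]; field_simp; ring
    linarith

theorem young_rpow_le {γ x y : ℝ} (hγ : 0 < γ) (hx : 0 ≤ x) (hy : 0 ≤ y) :
    (1 + γ) * (x * y ^ γ) ≤ x ^ (1 + γ) + γ * y ^ (1 + γ) := by
  rcases eq_or_ne x y with rfl | h
  · have : x ^ (1 + γ) = x * x ^ γ := by
      rw [Real.rpow_add_of_nonneg hx zero_le_one hγ.le, Real.rpow_one]
    rw [this]
    exact le_of_eq (by ring)
  · exact (young_rpow_lt_of_ne hγ hx hy h).le

/-- Equality case of the Young inequality in integrated form. -/
theorem ae_eq_of_integral_rpow_le {Ω : Type*} [MeasurableSpace Ω] {m : Measure Ω} {γ : ℝ}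
    (hγ : 0 < γ) {p r : Ω → ℝ} (hp0 : ∀ ω, 0 ≤ p ω) (hr0 : ∀ ω, 0 ≤ r ω)
    (hpi : Integrable (fun ω => p ω ^ (1 + γ)) m)
    (hri : Integrable (fun ω => r ω ^ (1 + γ)) m)
    (hpr : Integrable (fun ω => p ω * r ω ^ γ) m)
    (h : (∫ ω, p ω ^ (1 + γ) ∂m) + γ * ∫ ω, r ω ^ (1 + γ) ∂m
      ≤ (1 + γ) * ∫ ω, p ω * r ω ^ γ ∂m) : p =ᵐ[m] r := by
  have hi := hpi.add (hri.const_mul γ)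
  have hle : (fun ω => (1 + γ) * (p ω * r ω ^ γ)) ≤ᵐ[m]
      (fun ω => p ω ^ (1 + γ)) + fun ω => γ * r ω ^ (1 + γ) :=
    .of_forall fun ω => young_rpow_le hγ (hp0 ω) (hr0 ω)
  have heq : ∫ ω, (1 + γ) * (p ω * r ω ^ γ) ∂m
      = ∫ ω, ((fun ω => p ω ^ (1 + γ)) + fun ω => γ * r ω ^ (1 + γ)) ω ∂m := by
    refine le_antisymm (integral_mono_ae (hpr.const_mul _) hi hle) ?_
    rw [integral_add' hpi (hri.const_mul γ), integral_const_mul, integral_const_mul]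
    exact h
  filter_upwards [(integral_eq_iff_of_ae_le (hpr.const_mul _) hi hle).1 heq] with ω hω
  by_contra hne
  exact (young_rpow_lt_of_ne hγ (hp0 ω) (hr0 ω) hne).ne hω

theorem integrable_mul_rpow {Ω : Type*} [MeasurableSpace Ω] {m : Measure Ω} {γ : ℝ}
    (hγ : 0 < γ) {p r : Ω → ℝ} (hpm : Measurable p) (hrm : Measurable r)
    (hp0 : ∀ ω, 0 ≤ p ω) (hr0 : ∀ ω, 0 ≤ r ω)
    (hpi : Integrable (fun ω => p ω ^ (1 + γ)) m)
    (hri : Integrable (fun ω => r ω ^ (1 + γ)) m) :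
    Integrable (fun ω => p ω * r ω ^ γ) m := by
  refine (hpi.add (hri.const_mul γ)).mono' (hpm.mul (hrm.pow_const γ)).aestronglyMeasurable
    (.of_forall fun ω => ?_)
  have h0 : 0 ≤ p ω * r ω ^ γ := mul_nonneg (hp0 ω) (Real.rpow_nonneg (hr0 ω) _)
  rw [Real.norm_of_nonneg h0]
  have := young_rpow_le hγ (hp0 ω) (hr0 ω)
  simp only [Pi.add_apply]
  nlinarith [mul_nonneg hγ.le h0]

/-- If `p` and `q` are probability densities with `⟨p^(1+γ)⟩, ⟨q^(1+γ)⟩ ∈ (0,∞)` and the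
Hölder score satisfies `S(p,q) = S(p,p)`, i.e.
`φ(⟨p q^γ⟩/⟨q^(1+γ)⟩)·⟨q^(1+γ)⟩ = -⟨p^(1+γ)⟩`, then `p = q` almost everywhere. -/
theorem holder_score_eq_implies_ae_eq {Ω : Type*} [MeasurableSpace Ω] (m : Measure Ω)
    [SigmaFinite m] (γ : ℝ) (hγ : 0 < γ) (φ : ℝ → ℝ) (hφ1 : φ 1 = -1)
    (hφ : ∀ z : ℝ, 0 ≤ z → -z ^ (1 + γ) ≤ φ z)
    (p q : Ω → ℝ) (hpm : Measurable p) (hqm : Measurable q)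
    (hp0 : ∀ ω, 0 ≤ p ω) (hq0 : ∀ ω, 0 ≤ q ω)
    (hp1 : ∫ ω, p ω ∂m = 1) (hq1 : ∫ ω, q ω ∂m = 1)
    (hpi : Integrable (fun ω => p ω ^ (1 + γ)) m)
    (hqi : Integrable (fun ω => q ω ^ (1 + γ)) m)
    (hppos : 0 < ∫ ω, p ω ^ (1 + γ) ∂m)
    (hqpos : 0 < ∫ ω, q ω ^ (1 + γ) ∂m)
    (heq : φ ((∫ ω, p ω * q ω ^ γ ∂m) / ∫ ω, q ω ^ (1 + γ) ∂m) * (∫ ω, q ω ^ (1 + γ) ∂m)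
      = -∫ ω, p ω ^ (1 + γ) ∂m) :
    p =ᵐ[m] q := by
  set A := ∫ ω, p ω ^ (1 + γ) ∂m
  set B := ∫ ω, q ω ^ (1 + γ) ∂m
  set C := ∫ ω, p ω * q ω ^ γ ∂m
  have hs : 0 < 1 + γ := by positivity
  have hC : 0 ≤ C :=
    integral_nonneg fun ω => mul_nonneg (hp0 ω) (Real.rpow_nonneg (hq0 ω) _)
  have hAB : A / B ≤ (C / B) ^ (1 + γ) := by
    rw [div_le_iff₀ hqpos]
    nlinarith [mul_le_mul_of_nonneg_right (hφ (C / B) (div_nonneg hC hqpos.le)) hqpos.le]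
  obtain ⟨t, ht, htA⟩ : ∃ t : ℝ, 0 < t ∧ t ^ (1 + γ) = A / B :=
    ⟨(A / B) ^ (1 + γ)⁻¹, Real.rpow_pos_of_pos (div_pos hppos hqpos) _,
      Real.rpow_inv_rpow (div_pos hppos hqpos).le hs.ne'⟩
  have htC : t ≤ C / B := by
    rwa [← htA, Real.rpow_le_rpow_iff ht.le (div_nonneg hC hqpos.le) hs] at hAB
  have hr0 : ∀ ω, 0 ≤ t * q ω := fun ω => mul_nonneg ht.le (hq0 ω)
  have hrs : ∀ a : ℝ, (fun ω => (t * q ω) ^ a) = fun ω => t ^ a * q ω ^ a := fun a =>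
    funext fun ω => Real.mul_rpow ht.le (hq0 ω)
  have hri : Integrable (fun ω => (t * q ω) ^ (1 + γ)) m := by
    rw [hrs]; exact hqi.const_mul _
  have hrA : ∫ ω, (t * q ω) ^ (1 + γ) ∂m = A := by
    rw [hrs, integral_const_mul, htA]
    exact div_mul_cancel₀ A hqpos.ne'
  have hrC : ∫ ω, p ω * (t * q ω) ^ γ ∂m = t ^ γ * C := by
    rw [← integral_const_mul]
    congr 1 with ω
    rw [Real.mul_rpow ht.le (hq0 ω)]; ring
  have hAC : A ≤ t ^ γ * C := by
    have h1 : t ^ (1 + γ) * B = A := by rw [htA]; exact div_mul_cancel₀ A hqpos.ne'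
    rw [← h1, add_comm, Real.rpow_add ht, Real.rpow_one, mul_assoc]
    exact mul_le_mul_of_nonneg_left ((le_div_iff₀ hqpos).1 htC) (Real.rpow_nonneg ht.le _)
  have hpq : p =ᵐ[m] fun ω => t * q ω := by
    refine ae_eq_of_integral_rpow_le hγ hp0 hr0 hpi hri
      (integrable_mul_rpow hγ hpm (hqm.const_mul t) hp0 hr0 hpi hri) ?_
    rw [hrA, hrC]
    nlinarith [mul_le_mul_of_nonneg_left hAC hs.le]
  have ht1 : t = 1 := by
    have := integral_congr_ae hpq
    rw [integral_const_mul, hp1, hq1] at this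
    linarith
  simpa [ht1] using hpq
end

section
/- Let γ > 0 and let φ : [0,∞) → ℝ satisfy φ(1) = -1 and φ(z) ≥ -z^{1+γ} for all z ≥ 0. Let p, q be nonnegative measurable functions on ℝ^d with ⟨p^{1+γ}⟩ < ∞ and 0 < ⟨q^{1+γ}⟩ < ∞ (integrals with respect to Lebesgue measure). Then for every invertible matrix σ ∈ ℝ^{d×d} and every μ ∈ ℝ^d, the Hölder divergence satisfies D(p_{σ,μ}, q_{σ,μ}) = |det σ|^γ · D(p, q); in particular the Hölder divergence is affine invariant with scale function h(σ,μ) = |det σ|^{-γ}. -/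
open MeasureTheory

/-- The affine transformation `p ↦ p_{σ,μ}` of a density on `ℝ^d`:
`p_{σ,μ}(ω) = |det σ| · p(σω + μ)`. -/
noncomputable def affineTransform (d : ℕ) (σ : Matrix (Fin d) (Fin d) ℝ) (μ : Fin d → ℝ)
    (p : (Fin d → ℝ) → ℝ) : (Fin d → ℝ) → ℝ :=
  fun ω => |σ.det| * p (σ.mulVec ω + μ)

/-- The Hölder divergence on `ℝ^d` with Lebesgue measure:
`D(f,g) = φ(⟨f g^γ⟩/⟨g^(1+γ)⟩)·⟨g^(1+γ)⟩ + ⟨f^(1+γ)⟩`. -/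
noncomputable def holderDiv (d : ℕ) (γ : ℝ) (φ : ℝ → ℝ) (f g : (Fin d → ℝ) → ℝ) : ℝ :=
  φ ((∫ ω, f ω * g ω ^ γ) / ∫ ω, g ω ^ (1 + γ)) * (∫ ω, g ω ^ (1 + γ))
    + ∫ ω, f ω ^ (1 + γ)

/-- Affine change of variables for Lebesgue integrals of measurable functions. -/
theorem integral_comp_mulVec_add {d : ℕ} {σ : Matrix (Fin d) (Fin d) ℝ} (hσ : σ.det ≠ 0)
    (μ : Fin d → ℝ) {F : (Fin d → ℝ) → ℝ} (hF : Measurable F) :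
    ∫ ω, F (σ.mulVec ω + μ) = |σ.det|⁻¹ * ∫ ω, F ω := by
  have hmeas : Measurable (Matrix.toLin' σ) :=
    (LinearMap.continuous_of_finiteDimensional _).measurable
  have hmap : ∫ ω, F (Matrix.toLin' σ ω + μ)
      = ∫ ω, F (ω + μ) ∂(Measure.map (Matrix.toLin' σ) volume) :=
    (integral_map hmeas.aemeasurable
      (hF.comp (measurable_id.add_const μ)).aestronglyMeasurable).symm
  simp only [Matrix.toLin'_apply] at hmap
  rw [hmap, Real.map_matrix_volume_pi_eq_smul_volume_pi hσ, integral_smul_measure,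
    ENNReal.toReal_ofReal (abs_nonneg _), integral_add_right_eq_self F μ, abs_inv, smul_eq_mul]

/-- Scaling of the mixed moment `⟨f g^γ⟩` under a common affine transformation. -/
theorem integral_affineTransform_mul_rpow {d : ℕ} {σ : Matrix (Fin d) (Fin d) ℝ}
    (hσ : σ.det ≠ 0) (μ : Fin d → ℝ) {f g : (Fin d → ℝ) → ℝ} (hf : Measurable f)
    (hg : Measurable g) (hg0 : ∀ ω, 0 ≤ g ω) (γ : ℝ) :
    ∫ ω, affineTransform d σ μ f ω * affineTransform d σ μ g ω ^ γ
      = |σ.det| ^ γ * ∫ ω, f ω * g ω ^ γ := by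
  have hpt : ∀ ω, affineTransform d σ μ f ω * affineTransform d σ μ g ω ^ γ
      = |σ.det| * |σ.det| ^ γ * (f (σ.mulVec ω + μ) * g (σ.mulVec ω + μ) ^ γ) := by
    intro ω
    rw [affineTransform, affineTransform, Real.mul_rpow (abs_nonneg _) (hg0 _)]
    ring
  have hdet : |σ.det| ≠ 0 := abs_ne_zero.mpr hσ
  simp_rw [hpt]
  rw [integral_const_mul,
    integral_comp_mulVec_add hσ μ (F := fun ω => f ω * g ω ^ γ) (hf.mul (hg.pow_const γ))]
  field_simp

/-- Scaling of the moment `⟨f^(1+γ)⟩` under an affine transformation. -/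
theorem integral_affineTransform_rpow_one_add {d : ℕ} {σ : Matrix (Fin d) (Fin d) ℝ}
    (hσ : σ.det ≠ 0) (μ : Fin d → ℝ) {f : (Fin d → ℝ) → ℝ} (hf : Measurable f)
    (hf0 : ∀ ω, 0 ≤ f ω) {γ : ℝ} (hγ : 0 < γ) :
    ∫ ω, affineTransform d σ μ f ω ^ (1 + γ) = |σ.det| ^ γ * ∫ ω, f ω ^ (1 + γ) := by
  have hsplit : ∀ x : ℝ, 0 ≤ x → x ^ (1 + γ) = x * x ^ γ := fun x hx => by
    rw [Real.rpow_add_of_nonneg hx zero_le_one hγ.le, Real.rpow_one]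
  have haff : ∀ ω, 0 ≤ affineTransform d σ μ f ω := fun ω =>
    mul_nonneg (abs_nonneg _) (hf0 _)
  simp_rw [fun ω => hsplit _ (haff ω), fun ω => hsplit _ (hf0 ω)]
  exact integral_affineTransform_mul_rpow hσ μ hf hf hf0 γ

/-- The Hölder divergence is affine invariant:
`D(p_{σ,μ}, q_{σ,μ}) = |det σ|^γ · D(p,q)`, i.e. the scale function is `|det σ|^{-γ}`. -/
theorem holderDiv_affine_invariant (d : ℕ) (γ : ℝ) (hγ : 0 < γ)
    (φ : ℝ → ℝ) (hφ1 : φ 1 = -1) (hφ : ∀ z : ℝ, 0 ≤ z → -z ^ (1 + γ) ≤ φ z)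
    (p q : (Fin d → ℝ) → ℝ) (hpm : Measurable p) (hqm : Measurable q)
    (hp0 : ∀ ω, 0 ≤ p ω) (hq0 : ∀ ω, 0 ≤ q ω)
    (hpi : Integrable (fun ω => p ω ^ (1 + γ)))
    (hqi : Integrable (fun ω => q ω ^ (1 + γ)))
    (hqpos : 0 < ∫ ω, q ω ^ (1 + γ))
    (σ : Matrix (Fin d) (Fin d) ℝ) (hσ : σ.det ≠ 0) (μ : Fin d → ℝ) :
    holderDiv d γ φ (affineTransform d σ μ p) (affineTransform d σ μ q)
      = |σ.det| ^ γ * holderDiv d γ φ p q := by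
  unfold holderDiv
  rw [integral_affineTransform_mul_rpow hσ μ hpm hqm hq0 γ,
    integral_affineTransform_rpow_one_add hσ μ hqm hq0 hγ,
    integral_affineTransform_rpow_one_add hσ μ hpm hp0 hγ,
    mul_div_mul_left _ _ (Real.rpow_pos_of_pos (abs_pos.mpr hσ) γ).ne']
  ring
end

section
/- Let γ > 0 and z₀ ∈ [0,1). Suppose ξ : [0,∞) → ℝ is continuous, differentiable on (0,∞), and satisfies the differential equation ξ(x) + (1+γ)(z₀ - 1)·x·ξ'(x) = ξ(0) for all x > 0. Then for all x > 0, ξ(x) = ξ(0) + (ξ(1) - ξ(0))·x^{1/((1+γ)(1 - z₀))}. -/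
/-- The solution of the ODE `ξ(x) + (1+γ)(z₀-1)·x·ξ'(x) = ξ(0)` on `(0,∞)` with `γ > 0`
and `z₀ ∈ [0,1)` is `ξ(x) = ξ(0) + (ξ(1)-ξ(0))·x^(1/((1+γ)(1-z₀)))`. -/
theorem xi_ode_solution (γ z₀ : ℝ) (hγ : 0 < γ) (hz₀ : 0 ≤ z₀) (hz₀1 : z₀ < 1)
    (ξ ξ' : ℝ → ℝ) (hcont : ContinuousOn ξ (Set.Ici 0))
    (hderiv : ∀ x : ℝ, 0 < x → HasDerivAt ξ (ξ' x) x)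
    (hode : ∀ x : ℝ, 0 < x → ξ x + (1 + γ) * (z₀ - 1) * x * ξ' x = ξ 0) :
    ∀ x : ℝ, 0 < x → ξ x = ξ 0 + (ξ 1 - ξ 0) * x ^ (1 / ((1 + γ) * (1 - z₀))) := by
  have hc : 0 < (1 + γ) * (1 - z₀) := mul_pos (by linarith) (by linarith)
  set c := (1 + γ) * (1 - z₀) with hc_def
  have hg : ∀ x : ℝ, 0 < x →
      HasDerivAt (fun y => (ξ y - ξ 0) * y ^ (-(1 / c))) 0 x := by
    intro x hx
    have h := ((hderiv x hx).sub_const (ξ 0)).mul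
      (Real.hasDerivAt_rpow_const (p := -(1 / c)) (Or.inl hx.ne'))
    have hξ : ξ x - ξ 0 = c * x * ξ' x := by
      rw [hc_def]
      linear_combination hode x hx
    refine h.congr_deriv ?_
    rw [hξ, Real.rpow_sub_one hx.ne']
    field_simp
    ring
  intro x hx
  have hconst : (ξ x - ξ 0) * x ^ (-(1 / c)) = (ξ 1 - ξ 0) * (1 : ℝ) ^ (-(1 / c)) :=
    isOpen_Ioi.is_const_of_deriv_eq_zero (s := Set.Ioi (0 : ℝ)) isPreconnected_Ioi
      (fun y hy => (hg y hy).differentiableAt.differentiableWithinAt)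
      (fun y hy => (hg y hy).deriv) hx (Set.mem_Ioi.2 one_pos)
  have hpow : x ^ (-(1 / c)) * x ^ (1 / c) = 1 := by
    rw [← Real.rpow_add hx, neg_add_cancel, Real.rpow_zero]
  rw [Real.one_rpow, mul_one] at hconst
  linear_combination x ^ (1 / c) * hconst - (ξ x - ξ 0) * hpow
end

section
/- Let γ > 0, κ ≥ 1, and c > 0. Let J : [0,∞) → ℝ with J(0) = 0 be a function such that for every a > 0 and every measurable set A ⊆ ℝ of finite positive Lebesgue measure, the indicator-type function f = a·1_A satisfies c·(∫ f^{1+γ} dm)^{κ/(1+γ)} = ∫ J(f) dm, where m is Lebesgue measure on ℝ (i.e. c·(a^{1+γ} m(A))^{κ/(1+γ)} = J(a)·m(A)). Then κ = 1 + γ. Consequently, a separable Bregman potential G(f) = ⟨J(f)⟩ can equal ⟨f^{1+γ}⟩^{κ/(1+γ)} up to a positive constant factor only when κ = 1 + γ. -/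
open MeasureTheory

/-- If a separable Bregman potential `⟨J(f)⟩` equals `c·⟨f^(1+γ)⟩^(κ/(1+γ))` (with `c > 0`)
on all indicator-type functions `a·1_A` (with `a > 0` and `A ⊆ ℝ` of finite positive
Lebesgue measure), then `κ = 1 + γ`. -/
theorem separable_potential_forces_kappa (γ κ c : ℝ) (hγ : 0 < γ) (hκ : 1 ≤ κ) (hc : 0 < c)
    (J : ℝ → ℝ) (hJ0 : J 0 = 0)
    (h : ∀ a : ℝ, 0 < a → ∀ A : Set ℝ, MeasurableSet A →
      0 < volume A → volume A < ⊤ →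
      c * (a ^ (1 + γ) * (volume A).toReal) ^ (κ / (1 + γ)) = J a * (volume A).toReal) :
    κ = 1 + γ := by
  have key : (2 : ℝ) ^ (κ / (1 + γ)) = (2 : ℝ) ^ (1 : ℝ) := by
    have h₁ := h 1 one_pos (Set.Icc 0 1) measurableSet_Icc (by simp) (by simp)
    have h₂ := h 1 one_pos (Set.Icc 0 2) measurableSet_Icc (by simp) (by simp)
    simp only [Real.volume_Icc, sub_zero, ENNReal.toReal_ofReal zero_le_one,
      ENNReal.toReal_ofReal zero_le_two, Real.one_rpow, one_mul, mul_one] at h₁ h₂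
    rw [← h₁] at h₂
    rw [Real.rpow_one]
    exact mul_left_cancel₀ hc.ne' h₂
  have hexp : κ / (1 + γ) = 1 :=
    (Real.rpow_right_inj two_pos (by norm_num)).mp key
  rwa [div_eq_one_iff_eq (by positivity)] at hexp
end

section
/- Let a, b > 0 be fixed. Let U, V : (0,∞) → ℝ be continuously differentiable with U not constant, and let ψ : ℝ² → ℝ be differentiable. Suppose that for every x = (x₁, x₂) ∈ (0,∞)², the function (y₁,y₂) ↦ ψ(a·x₁U(y₁) + b·x₂U(y₂), a·V(y₁) + b·V(y₂)) on (0,∞)² attains a local minimum at (y₁,y₂) = (x₁,x₂), and that the gradient (ψ₁, ψ₂) of ψ is nonzero at the point (a·x₁U(x₁) + b·x₂U(x₂), a·V(x₁) + b·V(x₂)). Then x₁U'(x₁)V'(x₂) = x₂U'(x₂)V'(x₁) for all x₁, x₂ > 0, and consequently there exists a constant c ∈ ℝ such that V'(z) = c·z·U'(z) for all z > 0. -/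
/-- A nonzero linear functional on the plane cannot vanish on two linearly independent vectors. -/
theorem cross_eq_zero_of_apply_eq_zero {L : ℝ × ℝ →L[ℝ] ℝ} (hL : L ≠ 0) {u v w z : ℝ}
    (h₁ : L (u, v) = 0) (h₂ : L (w, z) = 0) : u * z = w * v := by
  have key (s t : ℝ) : L (s, t) = s * L (1, 0) + t * L (0, 1) := by
    have : ((s, t) : ℝ × ℝ) = s • (1, 0) + t • (0, 1) := by simp
    rw [this, map_add, map_smul, map_smul, smul_eq_mul, smul_eq_mul]
  rw [key] at h₁ h₂
  by_contra hne
  have hd : u * z - w * v ≠ 0 := sub_ne_zero.mpr hne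
  have hp : L (1, 0) = 0 := by
    refine (mul_eq_zero.mp ?_).resolve_left hd
    linear_combination z * h₁ - v * h₂
  have hq : L (0, 1) = 0 := by
    refine (mul_eq_zero.mp ?_).resolve_left hd
    linear_combination u * h₂ - w * h₁
  refine hL (ContinuousLinearMap.ext fun y => ?_)
  obtain ⟨s, t⟩ := y
  simp [key s t, hp, hq]

/-- At a local minimum of `ψ ∘ F` along a curve `γ`, the derivative of `ψ` annihilates the velocity
of `F ∘ γ`. -/
theorem IsLocalMin.fderiv_apply_eq_zero_of_curve {ψ : ℝ × ℝ → ℝ} {F : ℝ × ℝ → ℝ × ℝ}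
    {γ : ℝ → ℝ × ℝ} {t : ℝ} {v p : ℝ × ℝ} (hmin : IsLocalMin (fun y => ψ (F y)) (γ t))
    (hγ : ContinuousAt γ t) (hF : HasDerivAt (fun s => F (γ s)) v t) (hp : F (γ t) = p)
    (hψ : DifferentiableAt ℝ ψ p) : fderiv ℝ ψ p v = 0 := by
  subst hp
  have hloc : IsLocalMin (fun s => ψ (F (γ s))) t := hγ.eventually hmin
  exact hloc.hasDerivAt_eq_zero (hψ.hasFDerivAt.comp_hasDerivAt t hF)

/-- If for every `x = (x₁,x₂) ∈ (0,∞)²` the function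
`(y₁,y₂) ↦ ψ(a·x₁U(y₁) + b·x₂U(y₂), a·V(y₁) + b·V(y₂))` attains a local minimum at
`(x₁,x₂)` and the gradient of `ψ` there is nonzero, then
`x₁U'(x₁)V'(x₂) = x₂U'(x₂)V'(x₁)` for all `x₁,x₂ > 0`, and hence
`V'(z) = c·z·U'(z)` for some constant `c`. -/
theorem UV_relation (a b : ℝ) (ha : 0 < a) (hb : 0 < b)
    (U V U' V' : ℝ → ℝ)
    (hU : ∀ z : ℝ, 0 < z → HasDerivAt U (U' z) z)
    (hV : ∀ z : ℝ, 0 < z → HasDerivAt V (V' z) z)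
    (hU'c : ContinuousOn U' (Set.Ioi 0)) (hV'c : ContinuousOn V' (Set.Ioi 0))
    (hUnc : ∃ z₁ : ℝ, 0 < z₁ ∧ ∃ z₂ : ℝ, 0 < z₂ ∧ U z₁ ≠ U z₂)
    (ψ : ℝ × ℝ → ℝ) (hψ : Differentiable ℝ ψ)
    (hmin : ∀ x₁ : ℝ, 0 < x₁ → ∀ x₂ : ℝ, 0 < x₂ →
      IsLocalMin (fun y : ℝ × ℝ =>
        ψ (a * x₁ * U y.1 + b * x₂ * U y.2, a * V y.1 + b * V y.2)) (x₁, x₂))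
    (hgrad : ∀ x₁ : ℝ, 0 < x₁ → ∀ x₂ : ℝ, 0 < x₂ →
      fderiv ℝ ψ (a * x₁ * U x₁ + b * x₂ * U x₂, a * V x₁ + b * V x₂) ≠ 0) :
    (∀ x₁ : ℝ, 0 < x₁ → ∀ x₂ : ℝ, 0 < x₂ →
      x₁ * U' x₁ * V' x₂ = x₂ * U' x₂ * V' x₁)
    ∧ ∃ c : ℝ, ∀ z : ℝ, 0 < z → V' z = c * z * U' z := by
  have hrel : ∀ x₁ : ℝ, 0 < x₁ → ∀ x₂ : ℝ, 0 < x₂ →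
      x₁ * U' x₁ * V' x₂ = x₂ * U' x₂ * V' x₁ := by
    intro x₁ h₁ x₂ h₂
    have e₁ := IsLocalMin.fderiv_apply_eq_zero_of_curve
      (F := fun y => (a * x₁ * U y.1 + b * x₂ * U y.2, a * V y.1 + b * V y.2))
      (γ := fun s => (s, x₂)) (t := x₁) (hmin x₁ h₁ x₂ h₂) (by fun_prop)
      ((((hU x₁ h₁).const_mul (a * x₁)).add_const (b * x₂ * U x₂)).prodMk
        (((hV x₁ h₁).const_mul a).add_const (b * V x₂))) rfl (hψ _)
    have e₂ := IsLocalMin.fderiv_apply_eq_zero_of_curve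
      (F := fun y => (a * x₁ * U y.1 + b * x₂ * U y.2, a * V y.1 + b * V y.2))
      (γ := fun s => (x₁, s)) (t := x₂) (hmin x₁ h₁ x₂ h₂) (by fun_prop)
      ((((hU x₂ h₂).const_mul (b * x₂)).const_add (a * x₁ * U x₁)).prodMk
        (((hV x₂ h₂).const_mul b).const_add (a * V x₁))) rfl (hψ _)
    have hdet := cross_eq_zero_of_apply_eq_zero (hgrad x₁ h₁ x₂ h₂) e₁ e₂
    refine mul_left_cancel₀ (mul_pos ha hb).ne' ?_
    linear_combination hdet
  refine ⟨hrel, ?_⟩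
  obtain ⟨z₀, hz₀, hne⟩ : ∃ z₀ : ℝ, 0 < z₀ ∧ U' z₀ ≠ 0 := by
    by_contra! hzero
    obtain ⟨z₁, h₁, z₂, h₂, hne⟩ := hUnc
    exact hne (isOpen_Ioi.is_const_of_deriv_eq_zero isPreconnected_Ioi
      (fun z hz => (hU z hz).differentiableAt.differentiableWithinAt)
      (fun z hz => (hU z hz).deriv.trans (hzero z hz)) h₁ h₂)
  refine ⟨V' z₀ / (z₀ * U' z₀), fun z hz => ?_⟩
  have := hrel z hz z₀ hz₀
  have hz₀' := hz₀.ne'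
  field_simp
  linear_combination -this
end

section
/- Let s, b ∈ ℝ and let ψ : (0,∞)² → ℝ be differentiable and satisfy Euler's equation x·ψ₁(x,y) + y·ψ₂(x,y) - s·ψ(x,y) = b for all x, y > 0, where ψ₁, ψ₂ are the partial derivatives. Then: (i) if s ≠ 0, ψ(x,y) = (ψ(x/y, 1) + b/s)·y^s - b/s for all x, y > 0; (ii) if s = 0, ψ(x,y) = ψ(x/y, 1) + b·log y for all x, y > 0. In particular, there exists a function φ : (0,∞) → ℝ such that ψ(x,y) = φ(x/y)·y^s - b/s (case s ≠ 0) or ψ(x,y) = φ(x/y) + b·log y (case s = 0). -/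
/-- A function on `(0,∞)` with zero derivative is constant. -/
lemma eq_apply_one_of_hasDerivAt_zero {h : ℝ → ℝ}
    (hh : ∀ t : ℝ, 0 < t → HasDerivAt h 0 t) {t : ℝ} (ht : 0 < t) : h t = h 1 :=
  isOpen_Ioi.is_const_of_deriv_eq_zero isPreconnected_Ioi
    (fun u hu => (hh u hu).differentiableAt.differentiableWithinAt)
    (fun u hu => (hh u hu).deriv) ht (Set.mem_Ioi.2 one_pos)

/-- Solutions of the ordinary differential equation `t·g' = s·g + b` on `(0,∞)`, `s ≠ 0`. -/
lemma euler_ode_solution {s b : ℝ} (hs : s ≠ 0) {g : ℝ → ℝ}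
    (hg : ∀ t : ℝ, 0 < t → HasDerivAt g ((s * g t + b) / t) t) {t : ℝ} (ht : 0 < t) :
    g t = (g 1 + b / s) * t ^ s - b / s := by
  have hconst : (g t + b / s) * t ^ (-s) = (g 1 + b / s) * 1 ^ (-s) := by
    refine eq_apply_one_of_hasDerivAt_zero (h := fun u => (g u + b / s) * u ^ (-s))
      (fun u hu => ?_) ht
    refine (((hg u hu).add_const (b / s)).mul
      (Real.hasDerivAt_rpow_const (p := -s) (Or.inl hu.ne'))).congr_deriv ?_
    rw [Real.rpow_sub_one hu.ne']
    field_simp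
    ring
  rw [Real.one_rpow, mul_one] at hconst
  rw [← hconst, mul_assoc, ← Real.rpow_add ht, neg_add_cancel, Real.rpow_zero]
  ring

/-- Solutions of the ordinary differential equation `t·g' = b` on `(0,∞)`. -/
lemma euler_ode_solution_zero {b : ℝ} {g : ℝ → ℝ}
    (hg : ∀ t : ℝ, 0 < t → HasDerivAt g (b / t) t) {t : ℝ} (ht : 0 < t) :
    g t = g 1 + b * Real.log t := by
  have hconst : g t - b * Real.log t = g 1 - b * Real.log 1 := by
    refine eq_apply_one_of_hasDerivAt_zero (h := fun u => g u - b * Real.log u)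
      (fun u hu => ?_) ht
    refine ((hg u hu).sub ((Real.hasDerivAt_log hu.ne').const_mul b)).congr_deriv ?_
    rw [div_eq_mul_inv, sub_self]
  rw [Real.log_one] at hconst
  linarith

/-- Solutions of Euler's equation `x·ψ₁ + y·ψ₂ - s·ψ = b` on `(0,∞)²` are of the form
`ψ(x,y) = (ψ(x/y,1) + b/s)·y^s - b/s` when `s ≠ 0`, and
`ψ(x,y) = ψ(x/y,1) + b·log y` when `s = 0`. -/
theorem euler_pde_solution (s b : ℝ) (ψ : ℝ × ℝ → ℝ) (ψ₁ ψ₂ : ℝ → ℝ → ℝ)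
    (hψ : ∀ x : ℝ, 0 < x → ∀ y : ℝ, 0 < y →
      HasFDerivAt ψ
        (ψ₁ x y • ContinuousLinearMap.fst ℝ ℝ ℝ + ψ₂ x y • ContinuousLinearMap.snd ℝ ℝ ℝ)
        (x, y))
    (heuler : ∀ x : ℝ, 0 < x → ∀ y : ℝ, 0 < y →
      x * ψ₁ x y + y * ψ₂ x y - s * ψ (x, y) = b) :
    (s ≠ 0 → ∀ x : ℝ, 0 < x → ∀ y : ℝ, 0 < y →
      ψ (x, y) = (ψ (x / y, 1) + b / s) * y ^ s - b / s)
    ∧ (s = 0 → ∀ x : ℝ, 0 < x → ∀ y : ℝ, 0 < y →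
      ψ (x, y) = ψ (x / y, 1) + b * Real.log y) := by
  have hray : ∀ a : ℝ, 0 < a → ∀ t : ℝ, 0 < t →
      HasDerivAt (fun u => ψ (a * u, u)) ((s * ψ (a * t, t) + b) / t) t := by
    intro a ha t ht
    have hline : HasDerivAt (fun u : ℝ => (a * u, u)) (a, 1) t := by
      simpa using ((hasDerivAt_id t).const_mul a).prodMk (hasDerivAt_id t)
    refine (HasFDerivAt.comp_hasDerivAt (f := fun u : ℝ => (a * u, u)) t
      (hψ (a * t) (mul_pos ha ht) t ht) hline).congr_deriv ?_
    rw [eq_div_iff ht.ne', ← heuler (a * t) (mul_pos ha ht) t ht]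
    simp
    ring
  refine ⟨fun hs x hx y hy => ?_, fun hs x hx y hy => ?_⟩
  · simpa [div_mul_cancel₀ x hy.ne'] using
      euler_ode_solution hs (hray (x / y) (div_pos hx hy)) hy
  · subst hs
    simpa [div_mul_cancel₀ x hy.ne'] using
      euler_ode_solution_zero (g := fun u => ψ (x / y * u, u)) (b := b)
        (fun t ht => by simpa using hray (x / y) (div_pos hx hy) t ht) hy
end

section
/- Let γ > 0, s ∈ ℝ, and φ : [0,∞) → ℝ, and on Ω = ℝ^d with Lebesgue measure define H(f,g) = φ(⟨f g^γ⟩/⟨g^{1+γ}⟩)·⟨g^{1+γ}⟩^s for f a probability density with ⟨f^{1+γ}⟩ < ∞ and g a nonnegative measurable function with 0 < ⟨g^{1+γ}⟩ < ∞. Suppose that H(f,g) ≥ H(f,f) for all such pairs (f,g), and that H(p,q) = H(p,p) for probability densities p, q implies p = q almost everywhere. Then s > 0 > φ(1), and φ(z) ≥ φ(1)·z^{(1+γ)s} for all z ≥ 0. -/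
open MeasureTheory

/-- The candidate affine invariant composite score
`H(f,g) = φ(⟨f g^γ⟩/⟨g^(1+γ)⟩)·⟨g^(1+γ)⟩^s` on `ℝ^d` with Lebesgue measure. -/
noncomputable def Hscore (d : ℕ) (γ s : ℝ) (φ : ℝ → ℝ) (f g : (Fin d → ℝ) → ℝ) : ℝ :=
  φ ((∫ ω, f ω * g ω ^ γ) / ∫ ω, g ω ^ (1 + γ)) * (∫ ω, g ω ^ (1 + γ)) ^ s

/-- The integral of a product of two indicator-type functions. -/
lemma integral_indicator_const_mul_indicator_const {Ω : Type*} [MeasurableSpace Ω]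
    {μ : Measure Ω} {A B : Set Ω} (hA : MeasurableSet A) (hB : MeasurableSet B) (a b : ℝ) :
    ∫ ω, A.indicator (fun _ => a) ω * B.indicator (fun _ => b) ω ∂μ
      = μ.real (A ∩ B) * (a * b) := by
  simp_rw [← Set.inter_indicator_mul]
  rw [integral_indicator_const _ (hA.inter hB), smul_eq_mul]

lemma indicator_const_rpow {Ω : Type*} (A : Set Ω) (a : ℝ) {r : ℝ} (hr : r ≠ 0) (ω : Ω) :
    A.indicator (fun _ => a) ω ^ r = A.indicator (fun _ => a ^ r) ω := by
  by_cases h : ω ∈ A <;> simp [h, Real.zero_rpow hr]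

/-- The value of `Hscore` on scaled indicator functions. -/
lemma Hscore_indicator_const {d : ℕ} {γ : ℝ} (s : ℝ) (hγ : 0 < γ) (φ : ℝ → ℝ)
    {A B : Set (Fin d → ℝ)} (hA : MeasurableSet A) (hB : MeasurableSet B) (a b : ℝ) :
    Hscore d γ s φ (A.indicator fun _ => a) (B.indicator fun _ => b)
      = φ (volume.real (A ∩ B) * (a * b ^ γ) / (volume.real B * b ^ (1 + γ)))
        * (volume.real B * b ^ (1 + γ)) ^ s := by
  have h1 : 1 + γ ≠ 0 := by positivity
  unfold Hscore
  simp_rw [indicator_const_rpow _ _ hγ.ne', indicator_const_rpow _ _ h1]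
  rw [integral_indicator_const_mul_indicator_const hA hB, integral_indicator_const _ hB,
    smul_eq_mul]

lemma integrable_indicator_const_rpow {Ω : Type*} [MeasurableSpace Ω] {μ : Measure Ω}
    {A : Set Ω} (hA : MeasurableSet A) (hμ : μ A ≠ ⊤) (a : ℝ) {r : ℝ} (hr : r ≠ 0) :
    Integrable (fun ω => A.indicator (fun _ => a) ω ^ r) μ := by
  simp_rw [indicator_const_rpow _ _ hr]
  exact (integrable_indicator_iff hA).2 (integrableOn_const hμ)

/-- The box in `ℝ^d` which is `[l, u)` in the coordinate `i` and `[0, 1)` in the others. -/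
def slab {d : ℕ} (i : Fin d) (l u : ℝ) : Set (Fin d → ℝ) :=
  Set.univ.pi (Function.update (fun _ => Set.Ico 0 1) i (Set.Ico l u))

lemma mem_slab_apply {d : ℕ} {i : Fin d} {l u : ℝ} {x : Fin d → ℝ} (hx : x ∈ slab i l u) :
    x i ∈ Set.Ico l u := by
  simpa using hx i (Set.mem_univ i)

lemma slab_subset_slab {d : ℕ} (i : Fin d) (l : ℝ) {u v : ℝ} (h : u ≤ v) :
    slab i l u ⊆ slab i l v := by
  refine Set.pi_mono fun j _ => ?_
  by_cases hj : j = i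
  · subst hj
    simpa using Set.Ico_subset_Ico_right h
  · simp [hj]

lemma measurableSet_slab {d : ℕ} (i : Fin d) (l u : ℝ) : MeasurableSet (slab i l u) := by
  refine MeasurableSet.univ_pi fun j => ?_
  by_cases hj : j = i
  · subst hj
    simp
  · simp [hj]

lemma volume_slab {d : ℕ} (i : Fin d) (l u : ℝ) :
    volume (slab i l u) = ENNReal.ofReal (u - l) := by
  rw [slab, volume_pi_pi, Finset.prod_eq_single i]
  · simp
  · intro j _ hj
    simp [hj]
  · simp

lemma volume_real_slab {d : ℕ} (i : Fin d) {l u : ℝ} (h : l ≤ u) :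
    volume.real (slab i l u) = u - l := by
  rw [measureReal_def, volume_slab, ENNReal.toReal_ofReal (sub_nonneg.2 h)]

lemma disjoint_slab {d : ℕ} (i : Fin d) (l m u : ℝ) :
    Disjoint (slab i l m) (slab i m u) :=
  Set.disjoint_left.2 fun _ hx hy => (mem_slab_apply hx).2.not_ge (mem_slab_apply hy).1

/-- If `H(f,g) = φ(⟨f g^γ⟩/⟨g^(1+γ)⟩)·⟨g^(1+γ)⟩^s` is a composite score on
probability densities with finite `L^(1+γ)` integral versus nonnegative functions with
`0 < ⟨g^(1+γ)⟩ < ∞`, i.e. `H(f,g) ≥ H(f,f)` always and `H(p,q) = H(p,p)` for probability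
densities implies `p = q` a.e., then `s > 0 > φ(1)` and `φ(z) ≥ φ(1)·z^((1+γ)s)` for
all `z ≥ 0`. -/
theorem Hscore_sign_characterization (d : ℕ) (hd : 0 < d) (γ s : ℝ) (hγ : 0 < γ)
    (φ : ℝ → ℝ)
    (hge : ∀ f g : (Fin d → ℝ) → ℝ,
      Measurable f → (∀ ω, 0 ≤ f ω) → (∫ ω, f ω) = 1 →
      Integrable (fun ω => f ω ^ (1 + γ)) →
      Measurable g → (∀ ω, 0 ≤ g ω) →
      Integrable (fun ω => g ω ^ (1 + γ)) → 0 < ∫ ω, g ω ^ (1 + γ) →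
      Hscore d γ s φ f f ≤ Hscore d γ s φ f g)
    (heq : ∀ p q : (Fin d → ℝ) → ℝ,
      Measurable p → (∀ ω, 0 ≤ p ω) → (∫ ω, p ω) = 1 →
      Integrable (fun ω => p ω ^ (1 + γ)) →
      Measurable q → (∀ ω, 0 ≤ q ω) → (∫ ω, q ω) = 1 →
      Integrable (fun ω => q ω ^ (1 + γ)) → 0 < ∫ ω, q ω ^ (1 + γ) →
      Hscore d γ s φ p q = Hscore d γ s φ p p → p =ᵐ[volume] q) :
    0 < s ∧ φ 1 < 0 ∧ ∀ z : ℝ, 0 ≤ z → φ 1 * z ^ ((1 + γ) * s) ≤ φ z := by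
  have h1 : 1 + γ ≠ 0 := by positivity
  obtain ⟨i⟩ : Nonempty (Fin d) := ⟨⟨0, hd⟩⟩
  have hmeas (A : Set (Fin d → ℝ)) (hA : MeasurableSet A) (a : ℝ) :
      Measurable (A.indicator fun _ => a) := measurable_const.indicator hA
  have hnonneg (A : Set (Fin d → ℝ)) (a : ℝ) (ha : 0 ≤ a) (ω) :
      0 ≤ A.indicator (fun _ => a) ω := Set.indicator_nonneg (fun _ _ => ha) ω
  have hint (l u a : ℝ) : Integrable
      (fun ω => (slab i l u).indicator (fun _ => a) ω ^ (1 + γ)) :=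
    integrable_indicator_const_rpow (measurableSet_slab i l u)
      (by simp [volume_slab]) a h1
  have hone (l u : ℝ) (h : l < u) :
      ∫ ω, (slab i l u).indicator (fun _ => (u - l)⁻¹) ω = 1 := by
    rw [integral_indicator_const _ (measurableSet_slab i l u), volume_real_slab i h.le,
      smul_eq_mul, mul_inv_cancel₀ (sub_pos.2 h).ne']
  have hpos (l u b : ℝ) (h : l < u) (hb : 0 < b) :
      0 < ∫ ω, (slab i l u).indicator (fun _ => b) ω ^ (1 + γ) := by
    simp_rw [indicator_const_rpow _ _ h1]
    rw [integral_indicator_const _ (measurableSet_slab i l u), volume_real_slab i h.le,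
      smul_eq_mul]
    have := sub_pos.2 h
    positivity
  have hself (l u : ℝ) (h : l < u) :
      Hscore d γ s φ ((slab i l u).indicator fun _ => (u - l)⁻¹)
        ((slab i l u).indicator fun _ => (u - l)⁻¹) = φ 1 * ((u - l) ^ (-γ)) ^ s := by
    have hp := sub_pos.2 h
    rw [Hscore_indicator_const s hγ φ (measurableSet_slab i l u) (measurableSet_slab i l u),
      Set.inter_self, volume_real_slab i h.le, Real.rpow_add (inv_pos.2 hp), Real.rpow_one,
      div_self (by positivity), ← mul_assoc, mul_inv_cancel₀ hp.ne', one_mul,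
      Real.inv_rpow hp.le, Real.rpow_neg hp.le]
  have hle (l u l' u' b : ℝ) (h : l < u) (h' : l' < u') (hb : 0 < b) :
      φ 1 * ((u - l) ^ (-γ)) ^ s ≤ Hscore d γ s φ
        ((slab i l u).indicator fun _ => (u - l)⁻¹) ((slab i l' u').indicator fun _ => b) := by
    rw [← hself l u h]
    exact hge _ _ (hmeas _ (measurableSet_slab i l u) _)
      (hnonneg _ _ (inv_nonneg.2 (sub_pos.2 h).le)) (hone l u h) (hint l u _)
      (hmeas _ (measurableSet_slab i l' u') _) (hnonneg _ _ hb.le) (hint l' u' _)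
      (hpos l' u' b h' hb)
  have hscale (z : ℝ) (hz : 0 < z) : φ 1 * z ^ ((1 + γ) * s) ≤ φ z := by
    have h := hle 0 1 0 1 z⁻¹ one_pos one_pos (inv_pos.2 hz)
    have hz' : 0 < z ^ (1 + γ) := by positivity
    rw [Hscore_indicator_const s hγ φ (measurableSet_slab i 0 1) (measurableSet_slab i 0 1),
      Set.inter_self, volume_real_slab i zero_le_one] at h
    have hq : z⁻¹ ^ γ / z⁻¹ ^ (1 + γ) = z := by
      rw [← Real.rpow_sub (inv_pos.2 hz), sub_add_cancel_right, Real.rpow_neg_one, inv_inv]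
    simp only [sub_zero, inv_one, one_mul, Real.one_rpow, mul_one, hq] at h
    rw [Real.inv_rpow hz.le, Real.inv_rpow hz'.le, ← Real.rpow_mul hz.le,
      ← div_eq_mul_inv, le_div_iff₀ (by positivity)] at h
    exact h
  have hzero (a : ℝ) (ha : 0 < a) : φ 1 * (a ^ (-γ)) ^ s ≤ φ 0 := by
    have h := hle 0 a a (a + 1) 1 ha (lt_add_one a) one_pos
    rw [Hscore_indicator_const s hγ φ (measurableSet_slab i _ _) (measurableSet_slab i _ _),
      (disjoint_slab i 0 a (a + 1)).inter_eq,
      volume_real_slab i (lt_add_one a).le] at h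
    simpa using h
  have hhalf : Hscore d γ s φ ((slab i 0 (1 / 2)).indicator fun _ => (1 / 2 - 0 : ℝ)⁻¹)
      ((slab i 0 1).indicator fun _ => (1 : ℝ)) = φ 1 := by
    rw [Hscore_indicator_const s hγ φ (measurableSet_slab i _ _) (measurableSet_slab i _ _),
      Set.inter_eq_left.2 (slab_subset_slab i 0 (by norm_num)),
      volume_real_slab i (by norm_num), volume_real_slab i zero_le_one]
    norm_num
  have hne : φ 1 * ((1 / 2 - 0 : ℝ) ^ (-γ)) ^ s ≠ φ 1 := by
    intro h
    have hae := heq _ _ (hmeas _ (measurableSet_slab i 0 (1 / 2)) _)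
      (hnonneg _ _ (by norm_num)) (hone 0 (1 / 2) (by norm_num)) (hint 0 (1 / 2) _)
      (hmeas _ (measurableSet_slab i 0 1) 1) (hnonneg _ _ zero_le_one)
      (by simpa using hone 0 1 one_pos) (hint 0 1 1) (hpos 0 1 1 one_pos one_pos)
      (by rw [hhalf, hself 0 (1 / 2) (by norm_num), h])
    have hnull : volume (slab i 0 (1 / 2)) = 0 := by
      refine measure_mono_null (fun x hx => ?_) (mem_ae_iff.1 hae)
      intro hxe
      have hx' := slab_subset_slab i 0 (by norm_num : (1 / 2 : ℝ) ≤ 1) hx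
      simp only [Set.mem_ofPred_eq, Set.indicator_of_mem hx, Set.indicator_of_mem hx'] at hxe
      norm_num at hxe
    rw [volume_slab] at hnull
    norm_num at hnull
  have hlt : φ 1 * ((1 / 2 - 0 : ℝ) ^ (-γ)) ^ s < φ 1 :=
    lt_of_le_of_ne (hhalf ▸ hle 0 (1 / 2) 0 1 1 (by norm_num) one_pos one_pos) hne
  have hF : 1 < (1 / 2 - 0 : ℝ) ^ (-γ) :=
    Real.one_lt_rpow_of_pos_of_lt_one_of_neg (by norm_num) (by norm_num) (by linarith)
  have hs0 : s ≠ 0 := by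
    rintro rfl
    simp at hlt
  have hlinear (T : ℝ) (hT : 0 < T) : φ 1 * T ≤ φ 0 := by
    have h := hzero (T ^ (-(γ * s))⁻¹) (by positivity)
    rwa [← Real.rpow_mul (by positivity), ← Real.rpow_mul hT.le,
      show (-(γ * s))⁻¹ * (-γ * s) = 1 by field_simp, Real.rpow_one] at h
  have hφ : φ 1 < 0 := by
    rcases lt_trichotomy (φ 1) 0 with h | h | h
    · exact h
    · simp [h] at hlt
    · have h2 := hlinear (|φ 0| / φ 1 + 1) (by positivity)
      rw [mul_add, mul_div_cancel₀ _ h.ne'] at h2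
      linarith [le_abs_self (φ 0)]
  have hs : 0 < s := by
    by_contra hs
    have hp : ((1 / 2 - 0 : ℝ) ^ (-γ)) ^ s ≤ 1 :=
      Real.rpow_le_one_of_one_le_of_nonpos hF.le (not_lt.1 hs)
    nlinarith
  refine ⟨hs, hφ, fun z hz => ?_⟩
  rcases hz.eq_or_lt with rfl | hz
  · rw [Real.zero_rpow (mul_ne_zero h1 hs0), mul_zero]
    by_contra! h
    have h2 := hlinear (φ 0 / φ 1 / 2) (by have := div_pos_of_neg_of_neg h hφ; positivity)
    rw [← mul_div_assoc, mul_div_cancel₀ _ hφ.ne] at h2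
    linarith
  · exact hscale z hz
end

section
/- Let γ > 0 and κ ≥ 1. For all nonnegative measurable functions f, g on a σ-finite measure space with ⟨f^{1+γ}⟩ < ∞ and 0 < ⟨g^{1+γ}⟩ < ∞, the Bregman score with potential G(f) = ⟨f^{1+γ}⟩^{κ/(1+γ)} satisfies S(f,g) ≥ S(f,f), i.e. ⟨g^{1+γ}⟩^{κ/(1+γ)}·(1 - 1/κ - ⟨f g^γ⟩/⟨g^{1+γ}⟩) ≥ -(1/κ)·⟨f^{1+γ}⟩^{κ/(1+γ)}. -/
open MeasureTheory

/-- A nonnegative measurable function whose `p`-th power is integrable belongs to `L^p`. -/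
theorem memLp_ofReal_of_integrable_rpow {Ω : Type*} [MeasurableSpace Ω] {m : Measure Ω}
    {p : ℝ} (hp : 0 < p) {f : Ω → ℝ} (hfm : AEStronglyMeasurable f m) (hf0 : ∀ ω, 0 ≤ f ω)
    (hfi : Integrable (fun ω => f ω ^ p) m) : MemLp f (ENNReal.ofReal p) m := by
  rw [← integrable_norm_rpow_iff hfm (by simpa using hp) ENNReal.ofReal_ne_top,
    ENNReal.toReal_ofReal hp.le]
  simpa only [Real.norm_of_nonneg (hf0 _)] using hfi

/-- Hölder's inequality for `f` and `g ^ γ` with exponents `1 + γ` and `(1 + γ) / γ`. -/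
theorem integral_mul_rpow_le_of_nonneg {Ω : Type*} [MeasurableSpace Ω] {m : Measure Ω}
    {γ : ℝ} (hγ : 0 < γ) {f g : Ω → ℝ} (hfm : Measurable f) (hgm : Measurable g)
    (hf0 : ∀ ω, 0 ≤ f ω) (hg0 : ∀ ω, 0 ≤ g ω)
    (hfi : Integrable (fun ω => f ω ^ (1 + γ)) m)
    (hgi : Integrable (fun ω => g ω ^ (1 + γ)) m) :
    ∫ ω, f ω * g ω ^ γ ∂m
      ≤ (∫ ω, f ω ^ (1 + γ) ∂m) ^ (1 / (1 + γ)) * (∫ ω, g ω ^ (1 + γ) ∂m) ^ (γ / (1 + γ)) := by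
  have hpq : (1 + γ).HolderConjugate ((1 + γ) / γ) := by
    rw [Real.holderConjugate_iff]
    exact ⟨by linarith, by field_simp⟩
  have hpow : ∀ ω, (g ω ^ γ) ^ ((1 + γ) / γ) = g ω ^ (1 + γ) := fun ω => by
    rw [← Real.rpow_mul (hg0 ω), mul_div_cancel₀ _ hγ.ne']
  have h := integral_mul_le_Lp_mul_Lq_of_nonneg hpq
    (.of_forall hf0) (.of_forall fun ω => Real.rpow_nonneg (hg0 ω) γ)
    (memLp_ofReal_of_integrable_rpow hpq.pos hfm.aestronglyMeasurable hf0 hfi)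
    (memLp_ofReal_of_integrable_rpow hpq.symm.pos
      (hgm.pow_const γ).aestronglyMeasurable (fun ω => Real.rpow_nonneg (hg0 ω) γ)
      (by simpa only [hpow] using hgi))
  simpa only [hpow, one_div_div] using h

/-- Young's inequality `a * b ^ (κ - 1) ≤ a ^ κ / κ + b ^ κ * (κ - 1) / κ`, for the `p`-th roots
of `x` and `y`. -/
theorem rpow_mul_rpow_le_add_of_one_le {κ : ℝ} (hκ : 1 ≤ κ) (p : ℝ) {x y : ℝ}
    (hx : 0 ≤ x) (hy : 0 ≤ y) :
    x ^ (1 / p) * y ^ ((κ - 1) / p)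
      ≤ 1 / κ * x ^ (κ / p) + (1 - 1 / κ) * y ^ (κ / p) := by
  have hκ0 : 0 < κ := by linarith
  have h := Real.geom_mean_le_arith_mean2_weighted (w₁ := 1 / κ) (w₂ := 1 - 1 / κ)
    (by positivity) (sub_nonneg.2 ((div_le_one hκ0).2 hκ))
    (Real.rpow_nonneg hx (κ / p)) (Real.rpow_nonneg hy (κ / p)) (by ring)
  rw [← Real.rpow_mul hx, ← Real.rpow_mul hy] at h
  convert h using 3 <;> field_simp

/-- The Bregman score with potential `G(f) = ⟨f^(1+γ)⟩^(κ/(1+γ))` (for `γ > 0`, `κ ≥ 1`)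
satisfies `S(f,g) ≥ S(f,f)`:
`⟨g^(1+γ)⟩^(κ/(1+γ))·(1 - 1/κ - ⟨f g^γ⟩/⟨g^(1+γ)⟩) ≥ -(1/κ)·⟨f^(1+γ)⟩^(κ/(1+γ))`. -/
theorem bregman_holder_score_ge {Ω : Type*} [MeasurableSpace Ω] (m : Measure Ω)
    [SigmaFinite m] (γ κ : ℝ) (hγ : 0 < γ) (hκ : 1 ≤ κ)
    (f g : Ω → ℝ) (hfm : Measurable f) (hgm : Measurable g)
    (hf0 : ∀ ω, 0 ≤ f ω) (hg0 : ∀ ω, 0 ≤ g ω)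
    (hfi : Integrable (fun ω => f ω ^ (1 + γ)) m)
    (hgi : Integrable (fun ω => g ω ^ (1 + γ)) m)
    (hgpos : 0 < ∫ ω, g ω ^ (1 + γ) ∂m) :
    -(1 / κ) * (∫ ω, f ω ^ (1 + γ) ∂m) ^ (κ / (1 + γ))
      ≤ (∫ ω, g ω ^ (1 + γ) ∂m) ^ (κ / (1 + γ))
        * (1 - 1 / κ - (∫ ω, f ω * g ω ^ γ ∂m) / ∫ ω, g ω ^ (1 + γ) ∂m) := by
  set F := ∫ ω, f ω ^ (1 + γ) ∂m with hF
  set G := ∫ ω, g ω ^ (1 + γ) ∂m with hG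
  have hF0 : 0 ≤ F := integral_nonneg fun ω => Real.rpow_nonneg (hf0 ω) _
  have hholder := integral_mul_rpow_le_of_nonneg hγ hfm hgm hf0 hg0 hfi hgi
  rw [← hF, ← hG] at hholder
  have hyoung := rpow_mul_rpow_le_add_of_one_le hκ (1 + γ) hF0 hgpos.le
  have hexp : G ^ (κ / (1 + γ)) * G ^ (γ / (1 + γ)) / G = G ^ ((κ - 1) / (1 + γ)) := by
    rw [← Real.rpow_add hgpos, ← Real.rpow_sub_one hgpos.ne']
    congr 1
    field_simp
    ring
  have hcross : G ^ (κ / (1 + γ)) * ((∫ ω, f ω * g ω ^ γ ∂m) / G)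
      ≤ F ^ (1 / (1 + γ)) * G ^ ((κ - 1) / (1 + γ)) := by
    calc G ^ (κ / (1 + γ)) * ((∫ ω, f ω * g ω ^ γ ∂m) / G)
        ≤ G ^ (κ / (1 + γ)) * (F ^ (1 / (1 + γ)) * G ^ (γ / (1 + γ)) / G) := by gcongr
      _ = F ^ (1 / (1 + γ)) * G ^ ((κ - 1) / (1 + γ)) := by rw [← hexp]; ring
  linarith
end

section
/- Let γ > 0 and κ ≥ 1. For every z ≥ 0, sign(z - 1 + 1/κ)·κ^{(1+γ)/κ}·|z - 1 + 1/κ|^{(1+γ)/κ} ≤ z^{1+γ}, with equality at z = 1. Equivalently, the function φ(z) = -κ^{(1+γ)/κ}·|z - 1 + 1/κ|^{(1+γ)/κ}·sign(z - 1 + 1/κ) satisfies φ(z) ≥ -z^{1+γ} for all z ≥ 0 and φ(1) = -1, so it is an admissible function for the Hölder score with parameter γ. -/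
/-- For `γ > 0` and `κ ≥ 1`, the function
`φ(z) = -κ^((1+γ)/κ)·|z - 1 + 1/κ|^((1+γ)/κ)·sign(z - 1 + 1/κ)` satisfies
`φ(z) ≥ -z^(1+γ)` for all `z ≥ 0` and `φ(1) = -1`, so it is an admissible function for
the Hölder score with parameter `γ`. -/
theorem phi_admissible_for_holder (γ κ : ℝ) (hγ : 0 < γ) (hκ : 1 ≤ κ) (φ : ℝ → ℝ)
    (hφdef : φ = fun z : ℝ =>
      -(κ ^ ((1 + γ) / κ)) * |z - 1 + 1 / κ| ^ ((1 + γ) / κ) * Real.sign (z - 1 + 1 / κ)) :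
    (∀ z : ℝ, 0 ≤ z → -z ^ (1 + γ) ≤ φ z) ∧ φ 1 = -1 := by
  have hκ0 : 0 < κ := by linarith
  subst hφdef
  refine ⟨fun z hz => ?_, ?_⟩
  · rcases le_or_gt (z - 1 + 1 / κ) 0 with h | h
    · have hz' : 0 ≤ z ^ (1 + γ) := Real.rpow_nonneg hz _
      have hsign : Real.sign (z - 1 + 1 / κ) ≤ 0 := by
        rcases h.lt_or_eq with h | h
        · rw [Real.sign_of_neg h]; norm_num
        · rw [h, Real.sign_zero]
      have hc : 0 ≤ κ ^ ((1 + γ) / κ) * |z - 1 + 1 / κ| ^ ((1 + γ) / κ) := by positivity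
      have := mul_nonpos_of_nonneg_of_nonpos hc hsign
      linarith
    · have hb : κ * (z - 1 + 1 / κ) ≤ z ^ κ := by
        have := one_add_mul_self_le_rpow_one_add (s := z - 1) (by linarith) hκ
        rw [add_sub_cancel] at this
        calc κ * (z - 1 + 1 / κ) = 1 + κ * (z - 1) := by field_simp; ring
          _ ≤ z ^ κ := this
      have hmain : κ ^ ((1 + γ) / κ) * (z - 1 + 1 / κ) ^ ((1 + γ) / κ) ≤ z ^ (1 + γ) := by
        rw [← Real.mul_rpow hκ0.le h.le]
        calc (κ * (z - 1 + 1 / κ)) ^ ((1 + γ) / κ) ≤ (z ^ κ) ^ ((1 + γ) / κ) :=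
              Real.rpow_le_rpow (by positivity) hb (by positivity)
          _ = z ^ (1 + γ) := by rw [← Real.rpow_mul hz, mul_div_cancel₀ _ hκ0.ne']
      simp only [Real.sign_of_pos h, abs_of_pos h]
      linarith
  · have h : (0 : ℝ) < 1 / κ := by positivity
    simp only [sub_self, zero_add, Real.sign_of_pos h, abs_of_pos h, mul_one, neg_mul]
    rw [← Real.mul_rpow hκ0.le h.le, mul_one_div_cancel hκ0.ne', Real.one_rpow]
end

section
/- Let γ > 0 and κ ≥ 1, and let φ(z) = -κ^{(1+γ)/κ}·|z - 1 + 1/κ|^{(1+γ)/κ}·sign(z - 1 + 1/κ). Then φ is twice differentiable at z = 1 and φ''(1) = -γ(1+γ) + (κ-1)(1+γ). Consequently, φ''(1) = -γ(1+γ) holds if and only if κ = 1, i.e. among the Hölder scores equivalent with the Bregman scores S(f,g) = ⟨g^{1+γ}⟩^{κ/(1+γ)}(1 - 1/κ - ⟨f g^γ⟩/⟨g^{1+γ}⟩), only the case κ = 1 (the γ-score) satisfies the redescending condition φ''(1) = -γ(1+γ). -/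
/-- The function `φ(z) = -κ^((1+γ)/κ)·|z - 1 + 1/κ|^((1+γ)/κ)·sign(z - 1 + 1/κ)` is
twice differentiable at `z = 1` with `φ''(1) = -γ(1+γ) + (κ-1)(1+γ)`; consequently the
redescending condition `φ''(1) = -γ(1+γ)` holds if and only if `κ = 1`, i.e. only for
the γ-score. -/
theorem phi_second_deriv_redescending (γ κ : ℝ) (hγ : 0 < γ) (hκ : 1 ≤ κ) (φ : ℝ → ℝ)
    (hφdef : φ = fun z : ℝ =>
      -(κ ^ ((1 + γ) / κ)) * |z - 1 + 1 / κ| ^ ((1 + γ) / κ) * Real.sign (z - 1 + 1 / κ)) :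
    (∃ φ' : ℝ → ℝ, (∀ᶠ z in nhds (1 : ℝ), HasDerivAt φ (φ' z) z) ∧
      HasDerivAt φ' (-γ * (1 + γ) + (κ - 1) * (1 + γ)) 1)
    ∧ (-γ * (1 + γ) + (κ - 1) * (1 + γ) = -γ * (1 + γ) ↔ κ = 1) := by
  have hκ0 : 0 < κ := by linarith
  have hu : 0 < (1 : ℝ) - 1 + 1 / κ := by
    rw [sub_self, zero_add]
    positivity
  have hlin (z : ℝ) : HasDerivAt (fun z : ℝ => z - 1 + 1 / κ) 1 z :=
    ((hasDerivAt_id z).sub_const 1).add_const (1 / κ)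
  have hpos : ∀ᶠ z in nhds (1 : ℝ), 0 < z - 1 + 1 / κ :=
    (hlin 1).continuousAt.tendsto.eventually_const_lt hu
  set p := (1 + γ) / κ with hp
  have hpκ : κ * p = 1 + γ := by
    rw [hp]
    field_simp
  refine ⟨⟨fun z => -(κ ^ p) * (1 * p * (z - 1 + 1 / κ) ^ (p - 1)), ?_, ?_⟩, ?_⟩
  · filter_upwards [hpos.eventually_nhds] with z hz
    refine (((hlin z).rpow_const (p := p) (Or.inl hz.self_of_nhds.ne')).const_mul
      (-(κ ^ p))).congr_of_eventuallyEq ?_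
    filter_upwards [hz] with w hw
    simp only [hφdef]
    rw [abs_of_pos hw, Real.sign_of_pos hw, mul_one]
  · refine ((((hlin 1).rpow_const (p := p - 1) (Or.inl hu.ne')).const_mul
      (1 * p)).const_mul (-(κ ^ p))).congr_deriv ?_
    have hpow : κ ^ p * (1 / κ) ^ (p - 1 - 1) = κ ^ 2 := by
      rw [one_div, Real.inv_rpow hκ0.le, ← Real.rpow_neg hκ0.le, ← Real.rpow_add hκ0,
        ← Real.rpow_two]
      congr 1
      ring
    rw [sub_self, zero_add]
    linear_combination (-(p * (p - 1))) * hpow + (-(κ * p) - (1 + γ) + κ) * hpκ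
  · constructor
    · intro h
      have h' : (κ - 1) * (1 + γ) = 0 := by linarith
      rcases mul_eq_zero.mp h' with h | h <;> linarith
    · rintro rfl
      ring
end
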